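/- arXiv:2312.01165 — 6 statements merged into one kernel-verified Lean document; each statement's English description precedes it below -/
import Mathlib

section
/- Let d ≥ 1 and let L_f, L_G, B, M be positive real numbers. There exists a constant C₁ > 0, depending only on L_f, L_G, B and M, with the following property. Let f, g : ℝ^d → ℝ be continuously differentiable with ∇f Lipschitz with constant L_f and ∇g Lipschitz with constant L_G. Let 0 = t₀ < t₁ < ... < t_n = T be a partition with maximal step size Δt := max_i (t_{i+1} − t_i) satisfying Δt ≤ 1/(2 L_G). Let x, y : [0,T] → ℝ^d solve x'(t) = −∇f(x(t)) and y'(t) = −∇g(y(t)) with x(0) = y(0) = x₀, set x_i := x(t_i), J := Σ_{i=1}^n ‖y(t_i) − x_i‖², and assume max_{0≤i≤n} ‖∇g(x_i)‖ ≤ B and sup_{t∈[0,T]} (‖∇f(x(t))‖ + ‖∇g(y(t))‖) ≤ M. Then max_{t∈[0,T]} ‖x(t) − y(t)‖ ≤ C₁ (√J + (Δt)²). -/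
open scoped RealInnerProductSpace

lemma interp_aux {E : Type*} [NormedAddCommGroup E] [NormedSpace ℝ E] (e e' : ℝ → E)
    (a b K R h s : ℝ) (hab : a < b) (hK : 0 ≤ K) (hh : b - a ≤ h)
    (hs : s ∈ Set.Icc a b)
    (hd : ∀ r ∈ Set.Icc a b, HasDerivAt e (e' r) r)
    (hl : ∀ r ∈ Set.Icc a b, ∀ q ∈ Set.Icc a b, ‖e' r - e' q‖ ≤ K * ‖r - q‖)
    (ha : ‖e a‖ ≤ R) (hb : ‖e b‖ ≤ R) : ‖e s‖ ≤ R + 2 * K * h ^ 2 := by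
  obtain ⟨h1, h2⟩ := hs
  have key : ∀ r ∈ Set.Icc a b, ‖(e r - (r - s) • e' s) - (e s - (s - s) • e' s)‖
      ≤ (K * h) * ‖r - s‖ := by
    intro r hr
    refine Convex.norm_image_sub_le_of_norm_hasDerivWithin_le
      (f := fun r => e r - (r - s) • e' s) (f' := fun r => e' r - (1 : ℝ) • e' s)
      (s := Set.Icc a b) ?_ ?_ (convex_Icc a b) ⟨h1, h2⟩ hr
    · intro q hq
      exact ((hd q hq).sub (((hasDerivAt_id q).sub_const s).smul_const (e' s))).hasDerivWithinAt
    · intro q hq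
      rw [one_smul]
      refine (hl q hq s ⟨h1, h2⟩).trans (mul_le_mul_of_nonneg_left ?_ hK)
      rw [Real.norm_eq_abs, abs_le]
      obtain ⟨h3, h4⟩ := hq
      constructor <;> linarith
  have ka := key a ⟨le_refl _, hab.le⟩
  have kb := key b ⟨hab.le, le_refl _⟩
  simp only [sub_self, zero_smul, sub_zero] at ka kb
  have hKh : 0 ≤ K * h := mul_nonneg hK (by linarith)
  have na : ‖a - s‖ ≤ h := by
    rw [Real.norm_eq_abs, abs_le]; constructor <;> linarith
  have nb : ‖b - s‖ ≤ h := by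
    rw [Real.norm_eq_abs, abs_le]; constructor <;> linarith
  have ka' := ka.trans (mul_le_mul_of_nonneg_left na hKh)
  have kb' := kb.trans (mul_le_mul_of_nonneg_left nb hKh)
  have id : (b - a) • e s = (b - s) • (e a - (e a - (a - s) • e' s - e s))
      + (s - a) • (e b - (e b - (b - s) • e' s - e s)) := by
    module
  have n1 : ‖e a - (e a - (a - s) • e' s - e s)‖ ≤ R + K * h * h :=
    (norm_sub_le _ _).trans (add_le_add ha ka')
  have n2 : ‖e b - (e b - (b - s) • e' s - e s)‖ ≤ R + K * h * h :=
    (norm_sub_le _ _).trans (add_le_add hb kb')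
  have fin : (b - a) * ‖e s‖ ≤ (b - a) * (R + K * h * h) := by
    calc (b - a) * ‖e s‖ = ‖(b - a) • e s‖ := by
          rw [norm_smul, Real.norm_of_nonneg (by linarith)]
      _ ≤ (b - s) * (R + K * h * h) + (s - a) * (R + K * h * h) := by
          rw [id]
          refine (norm_add_le _ _).trans (add_le_add ?_ ?_)
          · rw [norm_smul, Real.norm_of_nonneg (by linarith)]
            exact mul_le_mul_of_nonneg_left n1 (by linarith)
          · rw [norm_smul, Real.norm_of_nonneg (by linarith)]
            exact mul_le_mul_of_nonneg_left n2 (by linarith)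
      _ = _ := by ring
  have := le_of_mul_le_mul_left fin (by linarith)
  nlinarith [mul_nonneg hK (sq_nonneg h)]

lemma part_aux (t : ℕ → ℝ) (n : ℕ) (hn : 1 ≤ n) (ht : ∀ i < n, t i < t (i + 1)) :
    ∀ s ∈ Set.Icc (t 0) (t n), ∃ i < n, s ∈ Set.Icc (t i) (t (i + 1)) := by
  induction n, hn using Nat.le_induction with
  | base => intro s hs; exact ⟨0, by simp, hs⟩
  | succ k hk ih =>
    intro s hs
    by_cases h : s ≤ t k
    · obtain ⟨i, hi, h'⟩ := ih (fun i hi => ht i (by omega)) s ⟨hs.1, h⟩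
      exact ⟨i, by omega, h'⟩
    · exact ⟨k, by omega, (not_le.1 h).le, hs.2⟩

lemma mono_aux (t : ℕ → ℝ) (n : ℕ) (ht : ∀ i < n, t i < t (i + 1)) :
    ∀ i j, i ≤ j → j ≤ n → t i ≤ t j := by
  intro i j hij
  induction j, hij using Nat.le_induction with
  | base => intro _; exact le_refl _
  | succ k hk ih => intro h; exact (ih (by omega)).trans (ht k (by omega)).le

/-- **Solution error bound for the optimal control network (Theorem 3.2, eq. (3.1)).**
There is a constant `C₁ > 0` depending only on `Lf, LG, B, M` such that for any `C¹`
functions `f, g` with Lipschitz gradients (constants `Lf`, `LG`), any partition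
`0 = t₀ < … < tₙ = T` with maximal step `Δt ≤ 1/(2 LG)`, and solutions `x, y` of the
gradient flows `x' = -∇f(x)`, `y' = -∇g(y)` from the same initial point, with training
loss `J = ∑ ‖y(tᵢ) - xᵢ‖²`, boundedness `‖∇g(xᵢ)‖ ≤ B` and
`‖∇f(x(t))‖ + ‖∇g(y(t))‖ ≤ M` on `[0,T]`, one has
`max_{[0,T]} ‖x(t) - y(t)‖ ≤ C₁ (√J + Δt²)`. -/
theorem solution_error_bound
    (d : ℕ) (hd : 1 ≤ d) (Lf LG B M : ℝ)
    (hLf : 0 < Lf) (hLG : 0 < LG) (hB : 0 < B) (hM : 0 < M) :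
    ∃ C₁ : ℝ, 0 < C₁ ∧
      ∀ (f g : EuclideanSpace ℝ (Fin d) → ℝ)
        (f' g' : EuclideanSpace ℝ (Fin d) → EuclideanSpace ℝ (Fin d)),
        (∀ z, HasGradientAt f (f' z) z) → Continuous f' →
        (∀ z, HasGradientAt g (g' z) z) → Continuous g' →
        (∀ u v, ‖f' u - f' v‖ ≤ Lf * ‖u - v‖) →
        (∀ u v, ‖g' u - g' v‖ ≤ LG * ‖u - v‖) →
        ∀ (n : ℕ) (hn : 1 ≤ n) (t : ℕ → ℝ) (T Δt : ℝ),
          t 0 = 0 → t n = T → (∀ i < n, t i < t (i + 1)) →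
          Δt = (Finset.range n).sup'
                (Finset.nonempty_range_iff.mpr (Nat.one_le_iff_ne_zero.mp hn))
                (fun i => t (i + 1) - t i) →
          Δt ≤ 1 / (2 * LG) →
          ∀ (x y : ℝ → EuclideanSpace ℝ (Fin d)) (x₀ : EuclideanSpace ℝ (Fin d)),
            x 0 = x₀ → y 0 = x₀ →
            (∀ s ∈ Set.Icc (0 : ℝ) T, HasDerivAt x (-(f' (x s))) s) →
            (∀ s ∈ Set.Icc (0 : ℝ) T, HasDerivAt y (-(g' (y s))) s) →
            ∀ J : ℝ,
              J = ∑ i ∈ Finset.range n, ‖y (t (i + 1)) - x (t (i + 1))‖ ^ 2 →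
              (∀ i ≤ n, ‖g' (x (t i))‖ ≤ B) →
              (∀ s ∈ Set.Icc (0 : ℝ) T, ‖f' (x s)‖ + ‖g' (y s)‖ ≤ M) →
              ∀ s ∈ Set.Icc (0 : ℝ) T,
                ‖x s - y s‖ ≤ C₁ * (Real.sqrt J + Δt ^ 2) := by
  have hKpos : 0 < (Lf + LG) * M := by positivity
  refine ⟨1 + 2 * ((Lf + LG) * M), by positivity, ?_⟩
  intro f g f' g' _ _ _ _ hfl hgl n hn t T Δt ht0 htn ht hΔ _ x y x₀ hx0 hy0 hx hy J hJ _ hMb s hs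
  have hJ0 : ∀ i ≤ n, ‖x (t i) - y (t i)‖ ≤ Real.sqrt J := by
    intro i hi
    rcases i with _ | i
    · rw [ht0, hx0, hy0]; simp
    · apply Real.le_sqrt_of_sq_le
      rw [hJ, norm_sub_rev]
      exact Finset.single_le_sum
        (f := fun i => ‖y (t (i + 1)) - x (t (i + 1))‖ ^ 2)
        (fun _ _ => by positivity) (Finset.mem_range.2 hi)
  obtain ⟨i, hi, hsi⟩ := part_aux t n hn ht s (by rw [ht0, htn]; exact hs)
  have hsub : ∀ r ∈ Set.Icc (t i) (t (i + 1)), r ∈ Set.Icc (0 : ℝ) T := by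
    intro r hr
    have h1 := mono_aux t n ht 0 i (by omega) (by omega)
    have h2 := mono_aux t n ht (i + 1) n (by omega) le_rfl
    rw [ht0] at h1
    rw [htn] at h2
    exact ⟨h1.trans hr.1, hr.2.trans h2⟩
  have hstep : t (i + 1) - t i ≤ Δt := by
    rw [hΔ]
    exact Finset.le_sup' (fun i => t (i + 1) - t i) (Finset.mem_range.2 hi)
  have hxl : ∀ r ∈ Set.Icc (0 : ℝ) T, ∀ q ∈ Set.Icc (0 : ℝ) T, ‖x r - x q‖ ≤ M * ‖r - q‖ := by
    intro r hr q hq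
    refine Convex.norm_image_sub_le_of_norm_hasDerivWithin_le
      (fun z hz => (hx z hz).hasDerivWithinAt) ?_ (convex_Icc 0 T) hq hr
    intro z hz
    rw [norm_neg]
    linarith [hMb z hz, norm_nonneg (g' (y z))]
  have hyl : ∀ r ∈ Set.Icc (0 : ℝ) T, ∀ q ∈ Set.Icc (0 : ℝ) T, ‖y r - y q‖ ≤ M * ‖r - q‖ := by
    intro r hr q hq
    refine Convex.norm_image_sub_le_of_norm_hasDerivWithin_le
      (fun z hz => (hy z hz).hasDerivWithinAt) ?_ (convex_Icc 0 T) hq hr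
    intro z hz
    rw [norm_neg]
    linarith [hMb z hz, norm_nonneg (f' (x z))]
  have main := interp_aux (fun r => x r - y r) (fun r => -(f' (x r)) - -(g' (y r)))
    (t i) (t (i + 1)) ((Lf + LG) * M) (Real.sqrt J) Δt s (ht i hi) hKpos.le hstep hsi
    (fun r hr => (hx r (hsub r hr)).sub (hy r (hsub r hr)))
    (by
      intro r hr q hq
      have e1 : (-(f' (x r)) - -(g' (y r))) - (-(f' (x q)) - -(g' (y q)))
          = (g' (y r) - g' (y q)) - (f' (x r) - f' (x q)) := by abel
      simp only [e1]
      have a1 := (hfl (x r) (x q)).trans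
        (mul_le_mul_of_nonneg_left (hxl r (hsub r hr) q (hsub q hq)) hLf.le)
      have a2 := (hgl (y r) (y q)).trans
        (mul_le_mul_of_nonneg_left (hyl r (hsub r hr) q (hsub q hq)) hLG.le)
      refine (norm_sub_le _ _).trans ?_
      linarith)
    (hJ0 i hi.le) (hJ0 (i + 1) hi)
  refine main.trans ?_
  nlinarith [mul_nonneg hKpos.le (Real.sqrt_nonneg J), sq_nonneg Δt]
end

section
/- Let g : ℝ^d → ℝ be continuously differentiable with ∇g Lipschitz with constant L_G, let Δt > 0 satisfy Δt · L_G < 1, and let y : [a, a+Δt] → ℝ^d satisfy y'(t) = −∇g(y(t)) for all t ∈ [a, a+Δt]. Then for any point z ∈ ℝ^d, sup_{t ∈ [a, a+Δt]} ‖y(t) − y(a)‖ ≤ (Δt / (1 − Δt·L_G)) · (‖∇g(z)‖ + L_G ‖y(a) − z‖). -/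
/-- **Local displacement bound for the learned flow (eq. (B.8) in the paper).**
If `∇g` is Lipschitz with constant `L_G`, `Δt · L_G < 1`, and `y' = -∇g(y)` on
`[a, a + Δt]`, then for any reference point `z`,
`sup_{t ∈ [a, a+Δt]} ‖y(t) - y(a)‖ ≤ (Δt / (1 - Δt L_G)) (‖∇g(z)‖ + L_G ‖y(a) - z‖)`. -/
theorem local_displacement_bound
    (d : ℕ) (LG Δt a : ℝ) (hΔt : 0 < Δt) (hΔtLG : Δt * LG < 1)
    (g : EuclideanSpace ℝ (Fin d) → ℝ)
    (g' : EuclideanSpace ℝ (Fin d) → EuclideanSpace ℝ (Fin d))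
    (hg : ∀ w, HasGradientAt g (g' w) w) (hgc : Continuous g')
    (hLG : ∀ u v, ‖g' u - g' v‖ ≤ LG * ‖u - v‖)
    (y : ℝ → EuclideanSpace ℝ (Fin d))
    (hy : ∀ t ∈ Set.Icc a (a + Δt), HasDerivAt y (-(g' (y t))) t)
    (z : EuclideanSpace ℝ (Fin d)) :
    ∀ t ∈ Set.Icc a (a + Δt),
      ‖y t - y a‖ ≤ (Δt / (1 - Δt * LG)) * (‖g' z‖ + LG * ‖y a - z‖) := by
  intro t ht
  have hpos : 0 < 1 - Δt * LG := by linarith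
  rcases lt_or_ge LG 0 with hneg | hnn
  · have key : ∀ u v : EuclideanSpace ℝ (Fin d), ‖u - v‖ = 0 := by
      intro u v
      have h1 := hLG u v
      have h2 := norm_nonneg (g' u - g' v)
      have h3 := norm_nonneg (u - v)
      nlinarith
    rw [key, key]
    have := norm_nonneg (g' z)
    have : 0 ≤ Δt / (1 - Δt * LG) := by positivity
    rw [mul_zero, add_zero]
    positivity
  · have hcont : ContinuousOn (fun s => ‖y s - y a‖) (Set.Icc a (a + Δt)) := by
      have : ContinuousOn y (Set.Icc a (a + Δt)) :=
        fun s hs => (hy s hs).continuousAt.continuousWithinAt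
      exact (this.sub continuousOn_const).norm
    obtain ⟨s, hs, hmax⟩ := isCompact_Icc.exists_isMaxOn ⟨t, ht⟩ hcont
    have hM : ∀ x ∈ Set.Icc a (a + Δt), ‖y x - y a‖ ≤ ‖y s - y a‖ := fun x hx => hmax hx
    have hbd := norm_image_sub_le_of_norm_deriv_le_segment'
      (C := ‖g' z‖ + LG * ‖y a - z‖ + LG * ‖y s - y a‖)
      (fun x hx => (hy x hx).hasDerivWithinAt) (by
        intro x hx
        have hx' := hM x (Set.Ico_subset_Icc_self hx)
        rw [norm_neg]
        have h1 : ‖g' (y x)‖ ≤ ‖g' (y x) - g' (y a)‖ + ‖g' (y a) - g' z‖ + ‖g' z‖ := by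
          have := norm_add₃_le (a := g' (y x) - g' (y a)) (b := g' (y a) - g' z) (c := g' z)
          simpa using this
        have h2 := hLG (y x) (y a)
        have h3 := hLG (y a) z
        have h4 := mul_le_mul_of_nonneg_left hx' hnn
        linarith) s hs
    have hC : 0 ≤ ‖g' z‖ + LG * ‖y a - z‖ + LG * ‖y s - y a‖ := by positivity
    have hsa : s - a ≤ Δt := by linarith [hs.2]
    have h5 := mul_le_mul_of_nonneg_left hsa hC
    refine (hM t ht).trans ?_
    rw [div_mul_eq_mul_div, le_div_iff₀ hpos]
    nlinarith
end

section
/- Fix s ≥ 1, Runge–Kutta coefficients a : Fin s × Fin s → ℝ and b : Fin s → ℝ, a step size τ > 0, and define b̃_i := b_i if b_i ≠ 0 and b̃_i := τ if b_i = 0. Let M_1, ..., M_s be symmetric d×d real matrices, and let δ_l, δ_{l+1}, p_l, p_{l+1} ∈ ℝ^d and stage vectors δ_i, d_i, p_i, h_i ∈ ℝ^d (i = 1,...,s) satisfy: d_i = −M_i δ_i; δ_i = δ_l + τ Σ_{j=1}^s a_{ij} d_j; δ_{l+1} = δ_l + τ Σ_{i=1}^s b_i d_i; h_i = M_i p_i;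 p_i = p_{l+1} − τ Σ_{j=1}^s b̃_j (a_{ji}/b_i) h_j whenever b_i ≠ 0, and p_i = −Σ_{j=1}^s b̃_j a_{ji} h_j whenever b_i = 0; and p_l = p_{l+1} − τ Σ_{i=1}^s b̃_i h_i. Then ⟨δ_{l+1}, p_{l+1}⟩ = ⟨δ_l, p_l⟩. -/
open Matrix

/-- **Discrete conservation of `⟨δ, p⟩` for the modified adjoint Runge–Kutta scheme
(Theorem 4.1 of the paper).**
One step of a Runge–Kutta method for the variational equation `δ' = -M δ` together
with the modified adjoint scheme (with weights `b̃ᵢ = bᵢ` if `bᵢ ≠ 0`, `b̃ᵢ = τ`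
otherwise) for the co-state equation `p' = Mᵀ p`, with symmetric stage matrices `Mᵢ`,
conserves the Euclidean inner product: `⟨δ_{l+1}, p_{l+1}⟩ = ⟨δ_l, p_l⟩`. -/
theorem rk_adjoint_conserves_bilinear
    (d s : ℕ) (hs : 1 ≤ s) (τ : ℝ) (hτ : 0 < τ)
    (a : Fin s → Fin s → ℝ) (b bt : Fin s → ℝ)
    (hbt : ∀ i, (b i ≠ 0 → bt i = b i) ∧ (b i = 0 → bt i = τ))
    (M : Fin s → Matrix (Fin d) (Fin d) ℝ) (hM : ∀ i, (M i).IsSymm)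
    (δl δl1 pl pl1 : Fin d → ℝ)
    (δs ds ps hsv : Fin s → (Fin d → ℝ))
    (hd : ∀ i, ds i = -((M i).mulVec (δs i)))
    (hδs : ∀ i, δs i = δl + τ • ∑ j, a i j • ds j)
    (hδl1 : δl1 = δl + τ • ∑ i, b i • ds i)
    (hh : ∀ i, hsv i = (M i).mulVec (ps i))
    (hps : ∀ i, b i ≠ 0 → ps i = pl1 - τ • ∑ j, (bt j * (a j i / b i)) • hsv j)
    (hps0 : ∀ i, b i = 0 → ps i = -∑ j, (bt j * a j i) • hsv j)
    (hpl : pl = pl1 - τ • ∑ i, bt i • hsv i) :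
    δl1 ⬝ᵥ pl1 = δl ⬝ᵥ pl := by
  have h1 : ∀ i, bt i * (ds i ⬝ᵥ ps i) = b i * (ds i ⬝ᵥ pl1)
      - τ * ∑ j, bt j * a j i * (ds i ⬝ᵥ hsv j) := by
    intro i
    by_cases hb : b i = 0
    · rw [(hbt i).2 hb, hps0 i hb, hb]
      simp only [dotProduct_neg, dotProduct_sum, dotProduct_smul, smul_eq_mul]
      ring
    · rw [(hbt i).1 hb, hps i hb]
      simp only [dotProduct_sub, dotProduct_sum, dotProduct_smul, smul_eq_mul]
      rw [mul_sub, mul_left_comm, Finset.mul_sum]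
      congr 2
      refine Finset.sum_congr rfl fun j _ => ?_
      field_simp
  have h2 : ∀ i, δs i ⬝ᵥ hsv i = δl ⬝ᵥ hsv i + τ * ∑ j, a i j * (ds j ⬝ᵥ hsv i) := by
    intro i
    rw [hδs i]
    simp only [add_dotProduct, smul_dotProduct, sum_dotProduct, smul_eq_mul]
  have h3 : ∀ i, ds i ⬝ᵥ ps i = -(δs i ⬝ᵥ hsv i) := by
    intro i
    rw [hd i, hh i, neg_dotProduct, dotProduct_mulVec, ← mulVec_transpose, (hM i).eq]
  have h4 : ∀ i, b i * (ds i ⬝ᵥ pl1) + bt i * (δl ⬝ᵥ hsv i)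
      = τ * ∑ j, bt j * a j i * (ds i ⬝ᵥ hsv j) - τ * ∑ j, bt i * a i j * (ds j ⬝ᵥ hsv i) := by
    intro i
    have e : ∑ j, bt i * a i j * (ds j ⬝ᵥ hsv i) = bt i * ∑ j, a i j * (ds j ⬝ᵥ hsv i) := by
      rw [Finset.mul_sum]
      exact Finset.sum_congr rfl fun j _ => by ring
    rw [e]
    have := h1 i
    rw [h3 i, h2 i] at this
    linarith
  have h5 : ∑ i, b i * (ds i ⬝ᵥ pl1) + ∑ i, bt i * (δl ⬝ᵥ hsv i) = 0 := by
    rw [← Finset.sum_add_distrib, Finset.sum_congr rfl fun i _ => h4 i,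
      Finset.sum_sub_distrib, ← Finset.mul_sum, ← Finset.mul_sum, Finset.sum_comm, sub_self]
  rw [hδl1, hpl]
  simp only [add_dotProduct, smul_dotProduct, sum_dotProduct, dotProduct_sub, dotProduct_sum,
    dotProduct_smul, smul_eq_mul]
  linear_combination τ * h5
end

section
/- Fix s ≥ 1, a step size τ > 0, and two sets of Runge–Kutta coefficients (a_{ij}, b_i) and (A_{ij}, B_i) with b_i ≠ 0 for all i, satisfying the compatibility conditions b_i A_{ij} + B_j a_{ji} − b_i B_j = 0 for all i, j and B_i = b_i for all i. Let M_1, ..., M_s be d×d real matrices, and let δ_l, δ_{l+1}, p_l, p_{l+1} ∈ ℝ^d and stage vectors δ_i, p_i ∈ ℝ^d satisfy the partitioned Runge–Kutta step: δ_i = δ_l + τ Σ_j a_{ij} (−M_j δ_j), δ_{l+1} = δ_l + τ Σ_i b_i (−M_i δ_i), p_i = p_l + τ Σ_j A_{ij} (M_jᵀ p_j), and p_{l+1} = p_l + τ Σ_i B_i (M_iᵀ p_i). Then ⟨δ_{l+1}, p_{l+1}⟩ = ⟨δ_l, p_l⟩. -/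
open Matrix

/-- **Symplecticity of partitioned Runge–Kutta methods for the variational/adjoint pair.**
One step of a partitioned Runge–Kutta method with coefficients `(aᵢⱼ, bᵢ)` for the
variational equation `δ' = -M δ` and `(Aᵢⱼ, Bᵢ)` for the adjoint equation `p' = Mᵀ p`,
where all `bᵢ ≠ 0` and the compatibility conditions
`bᵢ Aᵢⱼ + Bⱼ aⱼᵢ - bᵢ Bⱼ = 0` and `Bᵢ = bᵢ` hold, conserves the Euclidean inner
product: `⟨δ_{l+1}, p_{l+1}⟩ = ⟨δ_l, p_l⟩`. -/
theorem partitioned_rk_symplectic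
    (d s : ℕ) (hs : 1 ≤ s) (τ : ℝ) (hτ : 0 < τ)
    (a A : Fin s → Fin s → ℝ) (b B : Fin s → ℝ)
    (hb : ∀ i, b i ≠ 0)
    (hcompat : ∀ i j, b i * A i j + B j * a j i - b i * B j = 0)
    (hBb : ∀ i, B i = b i)
    (M : Fin s → Matrix (Fin d) (Fin d) ℝ)
    (δl δl1 pl pl1 : Fin d → ℝ)
    (δs ps : Fin s → (Fin d → ℝ))
    (hδs : ∀ i, δs i = δl + τ • ∑ j, a i j • (-((M j).mulVec (δs j))))
    (hδl1 : δl1 = δl + τ • ∑ i, b i • (-((M i).mulVec (δs i))))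
    (hps : ∀ i, ps i = pl + τ • ∑ j, A i j • ((M j)ᵀ.mulVec (ps j)))
    (hpl1 : pl1 = pl + τ • ∑ i, B i • ((M i)ᵀ.mulVec (ps i))) :
    δl1 ⬝ᵥ pl1 = δl ⬝ᵥ pl := by
  obtain ⟨k, hk⟩ : ∃ k : Fin s → (Fin d → ℝ), ∀ i, k i = -((M i).mulVec (δs i)) :=
    ⟨_, fun _ => rfl⟩
  obtain ⟨l, hl⟩ : ∃ l : Fin s → (Fin d → ℝ), ∀ i, l i = (M i)ᵀ.mulVec (ps i) :=
    ⟨_, fun _ => rfl⟩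
  have hkl : ∀ i, k i ⬝ᵥ ps i + δs i ⬝ᵥ l i = 0 := by
    intro i
    rw [hk, hl, Matrix.mulVec_transpose, neg_dotProduct, dotProduct_comm (δs i),
      ← Matrix.dotProduct_mulVec, dotProduct_comm (ps i)]
    ring
  simp only [← hk] at hδs hδl1
  simp only [← hl] at hps hpl1
  have h1 : ∀ i, k i ⬝ᵥ pl = k i ⬝ᵥ ps i - τ * ∑ j, A i j * (k i ⬝ᵥ l j) := by
    intro i
    conv_rhs => rw [hps i]
    simp only [dotProduct_add, dotProduct_smul, dotProduct_sum, smul_eq_mul]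
    ring
  have h2 : ∀ j, δl ⬝ᵥ l j = δs j ⬝ᵥ l j - τ * ∑ i, a j i * (k i ⬝ᵥ l j) := by
    intro j
    conv_rhs => rw [hδs j]
    simp only [add_dotProduct, smul_dotProduct, sum_dotProduct, smul_eq_mul]
    ring
  have e : δl1 ⬝ᵥ pl1 = δl ⬝ᵥ pl + τ * ∑ i, b i * (k i ⬝ᵥ pl) + τ * ∑ j, B j * (δl ⬝ᵥ l j)
      + τ ^ 2 * ∑ i, ∑ j, b i * B j * (k i ⬝ᵥ l j) := by
    have h3 : ∑ i, ∑ j, b i * B j * (k i ⬝ᵥ l j)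
        = (∑ i, b i • k i) ⬝ᵥ (∑ j, B j • l j) := by
      simp only [sum_dotProduct, dotProduct_sum, smul_dotProduct, dotProduct_smul, smul_eq_mul,
        Finset.mul_sum, mul_assoc]
      rw [Finset.sum_comm]
      exact Finset.sum_congr rfl fun i _ => Finset.sum_congr rfl fun j _ => by ring
    have h4 : ∑ i, b i * (k i ⬝ᵥ pl) = (∑ i, b i • k i) ⬝ᵥ pl := by
      simp only [sum_dotProduct, smul_dotProduct, smul_eq_mul]
    have h5 : ∑ j, B j * (δl ⬝ᵥ l j) = δl ⬝ᵥ (∑ j, B j • l j) := by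
      simp only [dotProduct_sum, dotProduct_smul, smul_eq_mul]
    rw [h3, h4, h5, hδl1, hpl1]
    simp only [add_dotProduct, dotProduct_add, smul_dotProduct, dotProduct_smul, smul_eq_mul]
    ring
  have h6 : ∑ i, b i * (k i ⬝ᵥ pl)
      = ∑ i, b i * (k i ⬝ᵥ ps i) - τ * ∑ i, ∑ j, b i * A i j * (k i ⬝ᵥ l j) := by
    simp only [h1, mul_sub, Finset.sum_sub_distrib, Finset.mul_sum]
    congr 1
    exact Finset.sum_congr rfl fun i _ => Finset.sum_congr rfl fun j _ => by ring
  have h7 : ∑ j, B j * (δl ⬝ᵥ l j)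
      = ∑ i, b i * (δs i ⬝ᵥ l i) - τ * ∑ i, ∑ j, B j * a j i * (k i ⬝ᵥ l j) := by
    rw [Finset.sum_comm]
    simp only [h2, mul_sub, Finset.sum_sub_distrib, Finset.mul_sum]
    congr 1
    · exact Finset.sum_congr rfl fun i _ => by rw [hBb]
    exact Finset.sum_congr rfl fun i _ => Finset.sum_congr rfl fun j _ => by ring
  have h8 : ∑ i, b i * (k i ⬝ᵥ ps i) + ∑ i, b i * (δs i ⬝ᵥ l i) = 0 := by
    rw [← Finset.sum_add_distrib]
    exact Finset.sum_eq_zero fun i _ => by rw [← mul_add, hkl, mul_zero]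
  have h9 : ∑ i, ∑ j, b i * A i j * (k i ⬝ᵥ l j) + ∑ i, ∑ j, B j * a j i * (k i ⬝ᵥ l j)
      - ∑ i, ∑ j, b i * B j * (k i ⬝ᵥ l j) = 0 := by
    simp only [← Finset.sum_add_distrib, ← Finset.sum_sub_distrib]
    exact Finset.sum_eq_zero fun i _ => Finset.sum_eq_zero fun j _ => by
      rw [← add_mul, ← sub_mul, hcompat, zero_mul]
  rw [e, h6, h7]
  linear_combination τ * h8 - τ ^ 2 * h9
end

section
/- Let 0 = t₀ < t₁ < ... < t_n = T be a partition, let A : [0,T] → Matrix(d,d,ℝ) and q : [0,T] → ℝ^d be continuous, and let z : [0,T] → ℝ^d satisfy z'(t) = −A(t) z(t) − q(t) for all t ∈ [0,T] with z(0) = 0. Let v₁, ..., v_n ∈ ℝ^d and let p₁, ..., p_n : [0,T] → ℝ^d be functions such that for each i, p_i satisfies p_i'(t) = (A(t))ᵀ p_i(t) for all t ∈ [t_{i−1}, t_i], with p_n(t_n) = v_n and the jump conditions p_i(t_i) = p_{i+1}(t_i) + v_i for i = 1, ..., n−1. Then Σ_{i=1}^n ⟨v_i, z(t_i)⟩ =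 −Σ_{i=1}^n ∫_{t_{i−1}}^{t_i} ⟨q(t), p_i(t)⟩ dt. -/
open Matrix

/-- **Multi-observation adjoint-method identity (Theorem 2.1 of the paper).**
Given a partition `0 = t₀ < t₁ < … < tₙ = T`, a sensitivity variable `z` solving
`z' = -A(t) z - q(t)` with `z(0) = 0`, and piecewise co-states `pᵢ` solving the
adjoint equation `pᵢ' = A(t)ᵀ pᵢ` on `[tᵢ₋₁, tᵢ]` with terminal condition
`pₙ(tₙ) = vₙ` and jump conditions `pᵢ(tᵢ) = pᵢ₊₁(tᵢ) + vᵢ`, one has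
`∑_{i=1}^n ⟨vᵢ, z(tᵢ)⟩ = -∑_{i=1}^n ∫_{tᵢ₋₁}^{tᵢ} ⟨q(t), pᵢ(t)⟩ dt`. -/
theorem multi_observation_adjoint_identity
    (d n : ℕ) (hn : 1 ≤ n) (t : ℕ → ℝ) (T : ℝ)
    (ht0 : t 0 = 0) (htn : t n = T) (htmono : ∀ i < n, t i < t (i + 1))
    (A : ℝ → Matrix (Fin d) (Fin d) ℝ) (q : ℝ → (Fin d → ℝ))
    (hA : ContinuousOn A (Set.Icc 0 T)) (hq : ContinuousOn q (Set.Icc 0 T))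
    (z : ℝ → (Fin d → ℝ))
    (hz : ∀ s ∈ Set.Icc (0 : ℝ) T, HasDerivAt z (-((A s).mulVec (z s)) - q s) s)
    (hz0 : z 0 = 0)
    (v : ℕ → (Fin d → ℝ)) (p : ℕ → ℝ → (Fin d → ℝ))
    (hp : ∀ i, 1 ≤ i → i ≤ n →
      ∀ s ∈ Set.Icc (t (i - 1)) (t i), HasDerivAt (p i) ((A s)ᵀ.mulVec (p i s)) s)
    (hpT : p n (t n) = v n)
    (hjump : ∀ i, 1 ≤ i → i ≤ n - 1 → p i (t i) = p (i + 1) (t i) + v i) :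
    ∑ i ∈ Finset.Icc 1 n, v i ⬝ᵥ z (t i) =
      -∑ i ∈ Finset.Icc 1 n, ∫ s in (t (i - 1))..(t i), q s ⬝ᵥ p i s := by
  have hmono : ∀ j, j ≤ n → ∀ i, i ≤ j → t i ≤ t j := by
    intro j
    induction j with
    | zero => intro _ i hi; rw [Nat.le_zero.mp hi]
    | succ k ih =>
      intro hk i hi
      rcases Nat.lt_or_ge k i with h | h
      · have : i = k + 1 := by omega
        rw [this]
      · exact (ih (by omega) i h).trans (htmono k (by omega)).le
  have hint : ∀ i, 1 ≤ i → i ≤ n → ∫ s in (t (i - 1))..(t i), q s ⬝ᵥ p i s =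
      p i (t (i - 1)) ⬝ᵥ z (t (i - 1)) - p i (t i) ⬝ᵥ z (t i) := by
    intro i h1 h2
    have hle : t (i - 1) ≤ t i := hmono i h2 _ (by omega)
    have hsub : Set.Icc (t (i - 1)) (t i) ⊆ Set.Icc 0 T := by
      apply Set.Icc_subset_Icc
      · rw [← ht0]; exact hmono _ (by omega) _ (by omega)
      · rw [← htn]; exact hmono _ le_rfl _ h2
    have hd : ∀ s ∈ Set.uIcc (t (i - 1)) (t i),
        HasDerivAt (fun s => -(p i s ⬝ᵥ z s)) (q s ⬝ᵥ p i s) s := by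
      intro s hs
      rw [Set.uIcc_of_le hle] at hs
      have hp' := hasDerivAt_pi.mp (hp i h1 h2 s hs)
      have hz' := hasDerivAt_pi.mp (hz s (hsub hs))
      have h := (HasDerivAt.fun_sum (u := Finset.univ)
        (fun j _ => (hp' j).mul (hz' j))).neg
      refine h.congr_deriv ?_
      rw [Finset.sum_add_distrib]
      change -((A s)ᵀ *ᵥ p i s ⬝ᵥ z s + p i s ⬝ᵥ (-(A s *ᵥ z s) - q s)) = _
      rw [dotProduct_sub, dotProduct_neg, Matrix.mulVec_transpose,
        ← Matrix.dotProduct_mulVec, dotProduct_comm (q s)]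
      ring
    have hc : ContinuousOn (fun s => q s ⬝ᵥ p i s) (Set.uIcc (t (i - 1)) (t i)) := by
      rw [Set.uIcc_of_le hle]
      have hpc : ContinuousOn (p i) (Set.Icc (t (i - 1)) (t i)) :=
        fun s hs => (hp i h1 h2 s hs).continuousAt.continuousWithinAt
      have hqc := hq.mono hsub
      exact continuousOn_finset_sum _ fun j _ =>
        (continuousOn_pi.mp hqc j).mul (continuousOn_pi.mp hpc j)
    rw [intervalIntegral.integral_eq_sub_of_hasDerivAt hd hc.intervalIntegrable]
    ring
  have key : ∀ k, 1 ≤ k → k ≤ n →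
      ∑ i ∈ Finset.Icc 1 k, ∫ s in (t (i - 1))..(t i), q s ⬝ᵥ p i s =
      -∑ i ∈ Finset.Icc 1 k, v i ⬝ᵥ z (t i) + v k ⬝ᵥ z (t k) - p k (t k) ⬝ᵥ z (t k) := by
    intro k hk
    induction k, hk using Nat.le_induction with
    | base =>
      intro h
      have := hint 1 le_rfl h
      simp only [Nat.sub_self, ht0, hz0, dotProduct_zero] at this
      simp [this, ht0]
    | succ k hk ih =>
      intro h
      rw [Finset.sum_Icc_succ_top (by omega), Finset.sum_Icc_succ_top (by omega),
        ih (by omega), hint (k + 1) (by omega) h, hjump k hk (by omega),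
        add_dotProduct, Nat.add_sub_cancel]
      ring
  rw [key n hn le_rfl, hpT]
  ring
end

section
/- Let f, g : ℝ^d → ℝ be continuously differentiable with ∇f Lipschitz with constant L_f and ∇g Lipschitz with constant L_G. Let x, y : [0,T] → ℝ^d solve x'(t) = −∇f(x(t)) and y'(t) = −∇g(y(t)) on [0,T], and let t_i < t_{i+1} be two points of [0,T] with Δt := t_{i+1} − t_i > 0. Set x_i := x(t_i), x_{i+1} := x(t_{i+1}), M_x := sup_{s∈[t_i,t_{i+1}]} ‖∇f(x(s))‖ and M_y := sup_{s∈[t_i,t_{i+1}]} ‖∇g(y(s))‖. Then ‖∇f(y(t_i)) − ∇g(y(t_i))‖ ≤ L_f ‖y(t_i) − x_i‖ + ((L_f M_x + L_G M_y)/2)·Δt + (‖y(t_{i+1}) − x_{i+1}‖ + ‖y(t_i) − x_i‖)/Δt. -/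
theorem flow_trunc_aux {E : Type*} [NormedAddCommGroup E] [NormedSpace ℝ E]
    (L : ℝ) (hL0 : 0 ≤ L) (F : E → E) (hF : Continuous F)
    (hL : ∀ u v, ‖F u - F v‖ ≤ L * ‖u - v‖) (x : ℝ → E) (a b : ℝ) (hab : a < b)
    (hx : ∀ s ∈ Set.Icc a b, HasDerivAt x (-(F (x s))) s) (M : ℝ)
    (hM : M = sSup ((fun s => ‖F (x s)‖) '' Set.Icc a b)) :
    ‖x b - x a + (b - a) • F (x a)‖ ≤ L * M * (b - a) ^ 2 / 2 := by
  have hxc : ContinuousOn x (Set.Icc a b) := fun s hs => (hx s hs).continuousAt.continuousWithinAt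
  have hb : BddAbove ((fun s => ‖F (x s)‖) '' Set.Icc a b) :=
    (isCompact_Icc.image_of_continuousOn (hF.comp_continuousOn hxc).norm).bddAbove
  have hle : ∀ s ∈ Set.Icc a b, ‖F (x s)‖ ≤ M := fun s hs => by
    rw [hM]; exact le_csSup hb ⟨s, hs, rfl⟩
  have h1 : ∀ s ∈ Set.Icc a b, ‖x s - x a‖ ≤ M * (s - a) :=
    norm_image_sub_le_of_norm_deriv_le_segment' (fun s hs => (hx s hs).hasDerivWithinAt)
      (fun s hs => by rw [norm_neg]; exact hle s ⟨hs.1, hs.2.le⟩)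
  have hd : ∀ s ∈ Set.Icc a b, HasDerivAt (fun s => x s - x a + (s - a) • F (x a))
      (-(F (x s)) + F (x a)) s := fun s hs => by
    have := ((hx s hs).sub_const (x a)).add
      (((hasDerivAt_id s).sub_const a).smul_const (F (x a)))
    rw [one_smul] at this
    exact this
  have hB : ∀ s, HasDerivAt (fun s => L * M * (s - a) ^ 2 / 2) (L * (M * (s - a))) s := fun s => by
    have := (((((hasDerivAt_id s).sub_const a).pow 2).const_mul (L * M)).div_const 2)
    refine this.congr_deriv ?_
    norm_num
    ring
  refine image_norm_le_of_norm_deriv_right_le_deriv_boundary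
    (f := fun s => x s - x a + (s - a) • F (x a))
    (B := fun s => L * M * (s - a) ^ 2 / 2)
    (fun s hs => (hd s hs).continuousAt.continuousWithinAt)
    (fun s hs => (hd s ⟨hs.1, hs.2.le⟩).hasDerivWithinAt) (by simp) hB ?_ ⟨hab.le, le_rfl⟩
  intro s hs
  rw [neg_add_eq_sub, norm_sub_rev]
  exact (hL _ _).trans (mul_le_mul_of_nonneg_left (h1 s ⟨hs.1, hs.2.le⟩) hL0)

/-- **Bound on the vector field discrepancy along the learned trajectory
(the estimate for `D₃`, eq. (B.10) in the paper).**
If `x' = -∇f(x)` and `y' = -∇g(y)` on `[0, T]` with `∇f`, `∇g` Lipschitz of constants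
`L_f`, `L_G`, and `tᵢ < tᵢ₊₁` in `[0, T]` with `Δt = tᵢ₊₁ - tᵢ`,
`M_x = sup_{[tᵢ, tᵢ₊₁]} ‖∇f(x(s))‖`, `M_y = sup_{[tᵢ, tᵢ₊₁]} ‖∇g(y(s))‖`, then
`‖∇f(y(tᵢ)) - ∇g(y(tᵢ))‖ ≤ L_f ‖y(tᵢ) - xᵢ‖ + ((L_f M_x + L_G M_y)/2) Δt
  + (‖y(tᵢ₊₁) - xᵢ₊₁‖ + ‖y(tᵢ) - xᵢ‖)/Δt`. -/
theorem vector_field_discrepancy_bound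
    (d : ℕ) (Lf LG T : ℝ)
    (f g : EuclideanSpace ℝ (Fin d) → ℝ)
    (f' g' : EuclideanSpace ℝ (Fin d) → EuclideanSpace ℝ (Fin d))
    (hf : ∀ z, HasGradientAt f (f' z) z) (hfc : Continuous f')
    (hg : ∀ z, HasGradientAt g (g' z) z) (hgc : Continuous g')
    (hLf : ∀ u v, ‖f' u - f' v‖ ≤ Lf * ‖u - v‖)
    (hLG : ∀ u v, ‖g' u - g' v‖ ≤ LG * ‖u - v‖)
    (x y : ℝ → EuclideanSpace ℝ (Fin d))
    (hx : ∀ s ∈ Set.Icc (0 : ℝ) T, HasDerivAt x (-(f' (x s))) s)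
    (hy : ∀ s ∈ Set.Icc (0 : ℝ) T, HasDerivAt y (-(g' (y s))) s)
    (ti tip : ℝ) (hti : ti ∈ Set.Icc (0 : ℝ) T) (htip : tip ∈ Set.Icc (0 : ℝ) T)
    (hlt : ti < tip)
    (Δt : ℝ) (hΔt : Δt = tip - ti)
    (Mx My : ℝ)
    (hMx : Mx = sSup ((fun s => ‖f' (x s)‖) '' Set.Icc ti tip))
    (hMy : My = sSup ((fun s => ‖g' (y s)‖) '' Set.Icc ti tip)) :
    ‖f' (y ti) - g' (y ti)‖ ≤
      Lf * ‖y ti - x ti‖ + ((Lf * Mx + LG * My) / 2) * Δt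
        + (‖y tip - x tip‖ + ‖y ti - x ti‖) / Δt := by
  rcases Nat.eq_zero_or_pos d with rfl | hd
  · have h0 : ∀ v : EuclideanSpace ℝ (Fin 0), ‖v‖ = 0 := fun v => by
      rw [Subsingleton.elim v 0, norm_zero]
    have hne : (Set.Icc ti tip).Nonempty := ⟨ti, le_rfl, hlt.le⟩
    simp only [h0, hne.image_const, csSup_singleton] at hMx hMy ⊢
    simp [hMx, hMy]
  have hv : ‖EuclideanSpace.single (⟨0, hd⟩ : Fin d) (1 : ℝ) - 0‖ = 1 := by simp
  have hLf0 : 0 ≤ Lf := by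
    have := (norm_nonneg _).trans (hLf (EuclideanSpace.single ⟨0, hd⟩ 1) 0)
    rwa [hv, mul_one] at this
  have hLG0 : 0 ≤ LG := by
    have := (norm_nonneg _).trans (hLG (EuclideanSpace.single ⟨0, hd⟩ 1) 0)
    rwa [hv, mul_one] at this
  have hsub : ∀ s ∈ Set.Icc ti tip, s ∈ Set.Icc (0 : ℝ) T :=
    fun s hs => ⟨hti.1.trans hs.1, hs.2.trans htip.2⟩
  have hX := flow_trunc_aux Lf hLf0 f' hfc hLf x ti tip hlt (fun s hs => hx s (hsub s hs)) Mx hMx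
  have hY := flow_trunc_aux LG hLG0 g' hgc hLG y ti tip hlt (fun s hs => hy s (hsub s hs)) My hMy
  rw [← hΔt] at hX hY
  have hpos : 0 < Δt := by linarith
  have h2 : Δt * ‖f' (x ti) - g' (y ti)‖ ≤ Lf * Mx * Δt ^ 2 / 2 + LG * My * Δt ^ 2 / 2
      + (‖y tip - x tip‖ + ‖y ti - x ti‖) := by
    have e : Δt • (f' (x ti) - g' (y ti)) = ((x tip - x ti + Δt • f' (x ti))
        - (y tip - y ti + Δt • g' (y ti))) + ((y tip - x tip) - (y ti - x ti)) := by
      rw [smul_sub]; abel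
    rw [← abs_of_pos hpos, ← Real.norm_eq_abs, ← norm_smul, Real.norm_eq_abs, abs_of_pos hpos, e]
    exact (norm_add_le _ _).trans (add_le_add
      ((norm_sub_le _ _).trans (add_le_add hX hY)) (norm_sub_le _ _))
  have h3 : ‖f' (x ti) - g' (y ti)‖ ≤ ((Lf * Mx + LG * My) / 2) * Δt
        + (‖y tip - x tip‖ + ‖y ti - x ti‖) / Δt := by
    refine le_of_mul_le_mul_left (h2.trans (le_of_eq ?_)) hpos
    field_simp
  have h4 := norm_sub_le_norm_sub_add_norm_sub (f' (y ti)) (f' (x ti)) (g' (y ti))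
  have h5 := hLf (y ti) (x ti)
  linarith
end
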